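/- Let A be a finite quantum group with Haar state h and let p ∈ A be a good group-like projection. Define Δ₀(x) := (p ⊗ p)·Δ(x)·(p ⊗ p) for x ∈ p A p. Then the restriction of the antipode S to p A p maps p A p into itself and satisfies, for all a, b ∈ A: S((id ⊗ h)(Δ₀(p a p)·(1 ⊗ p b p))) = (id ⊗ h)((1 ⊗ p a p)·Δ₀(p b p)). -/

import Mathlib

open TensorProduct HopfAlgebra
open scoped ComplexOrder

noncomputable section

variable {A : Type*} [Ring A] [StarRing A] [HopfAlgebra ℂ A]
  [StarModule ℂ A] [FiniteDimensional ℂ A]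

/-- Convolution of linear functionals on a coalgebra: `φ ⋆ ψ := (φ ⊗ ψ) ∘ Δ`. -/
def conv (φ ψ : A →ₗ[ℂ] ℂ) : A →ₗ[ℂ] ℂ :=
  LinearMap.mul' ℂ ℂ ∘ₗ TensorProduct.map φ ψ ∘ₗ Coalgebra.comul

/-- A state: a unital positive linear functional. -/
def IsState (φ : A →ₗ[ℂ] ℂ) : Prop :=
  φ 1 = 1 ∧ ∀ a : A, 0 ≤ φ (star a * a)

/-- An idempotent state: a state satisfying `φ ⋆ φ = φ`. -/
def IsIdempotentState (φ : A →ₗ[ℂ] ℂ) : Prop :=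
  IsState φ ∧ conv φ φ = φ

/-- The Haar state axioms: a faithful state which is a trace and two-sided invariant,
`(h ⊗ id)(Δ a) = h(a)·1 = (id ⊗ h)(Δ a)`. -/
structure IsHaarState (h : A →ₗ[ℂ] ℂ) : Prop where
  state : IsState h
  faithful : ∀ a : A, h (star a * a) = 0 → a = 0
  left_inv : ∀ a : A,
    TensorProduct.lid ℂ A (TensorProduct.map h LinearMap.id (Coalgebra.comul a)) = h a • 1
  right_inv : ∀ a : A,
    TensorProduct.rid ℂ A (TensorProduct.map LinearMap.id h (Coalgebra.comul a)) = h a • 1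
  trace : ∀ a b : A, h (a * b) = h (b * a)

/-- The star-compatibility axioms of a finite quantum group (finite-dimensional Hopf
`*`-algebra): the comultiplication is `*`-preserving (with respect to the entrywise star
`tstar` on `A ⊗ A`, given as data), and the antipode is `*`-preserving and involutive. -/
structure StarAxioms (tstar : A ⊗[ℂ] A →+ A ⊗[ℂ] A) : Prop where
  tstar_tmul : ∀ a b : A, tstar (a ⊗ₜ[ℂ] b) = star a ⊗ₜ[ℂ] star b
  comul_star : ∀ a : A, Coalgebra.comul (R := ℂ) (star a) = tstar (Coalgebra.comul a)
  antipode_star : ∀ a : A, antipode (R := ℂ) (star a) = star (antipode (R := ℂ) a)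
  antipode_invol : ∀ a : A, antipode (R := ℂ) (antipode (R := ℂ) a) = a

/-- A group-like projection: a nonzero self-adjoint idempotent `p` with
`Δ(p)(1 ⊗ p) = p ⊗ p`. -/
def IsGroupLikeProjection (p : A) : Prop :=
  p ≠ 0 ∧ star p = p ∧ p * p = p ∧
    Coalgebra.comul (R := ℂ) p * ((1 : A) ⊗ₜ[ℂ] p) = p ⊗ₜ[ℂ] p

/-- A good group-like projection: a group-like projection with `Δ(p)(p ⊗ 1) = p ⊗ p`
and `S(p) = p`. -/
def IsGoodGroupLikeProjection (p : A) : Prop :=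
  IsGroupLikeProjection p ∧
    Coalgebra.comul (R := ℂ) p * (p ⊗ₜ[ℂ] (1 : A)) = p ⊗ₜ[ℂ] p ∧
    antipode (R := ℂ) p = p

/-- The slice map `id ⊗ h : H ⊗ H → H`. -/
def rightSlice {H : Type*} [Ring H] [HopfAlgebra ℂ H] (h : H →ₗ[ℂ] ℂ) :
    H ⊗[ℂ] H →ₗ[ℂ] H :=
  (TensorProduct.rid ℂ H).toLinearMap ∘ₗ TensorProduct.map LinearMap.id h

lemma rightSlice_tmul {H : Type*} [Ring H] [HopfAlgebra ℂ H]
    (h : H →ₗ[ℂ] ℂ) (x y : H) : rightSlice h (x ⊗ₜ y) = h y • x := by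
  simp [rightSlice]

lemma rightSlice_tmul_mul {H : Type*} [Ring H] [HopfAlgebra ℂ H]
    (h : H →ₗ[ℂ] ℂ) (x y : H) (w : H ⊗[ℂ] H) :
    rightSlice h ((x ⊗ₜ y) * w) = x * rightSlice h (((1 : H) ⊗ₜ y) * w) := by
  induction w with
  | zero => simp
  | tmul u v => simp [rightSlice_tmul]
  | add u v hu hv => rw [mul_add, map_add, hu, hv, mul_add, map_add, mul_add]

/-- Strong invariance of the Haar state:
`S((id ⊗ h)(Δ(a)(1 ⊗ b))) = (id ⊗ h)((1 ⊗ a)Δ(b))`. -/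
lemma antipode_rightSlice_comul_mul {H : Type*} [Ring H] [StarRing H] [HopfAlgebra ℂ H]
    {h : H →ₗ[ℂ] ℂ} (hh : IsHaarState h) (a b : H) :
    antipode ℂ (rightSlice h (Coalgebra.comul (R := ℂ) a * ((1 : H) ⊗ₜ[ℂ] b)))
      = rightSlice h (((1 : H) ⊗ₜ[ℂ] a) * Coalgebra.comul (R := ℂ) b) := by
  have right_inv (x : H) : rightSlice h (Coalgebra.comul (R := ℂ) x) = h x • 1 := hh.right_inv x
  let K : H →ₗ[ℂ] H := rightSlice h ∘ₗ LinearMap.mulRight ℂ (Coalgebra.comul (R := ℂ) b) ∘ₗ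
    TensorProduct.mk ℂ H H 1
  have hK (x y : H) :
      rightSlice h ((x ⊗ₜ[ℂ] y) * Coalgebra.comul (R := ℂ) b) = x * K y :=
    rightSlice_tmul_mul h x y _
  let G : H ⊗[ℂ] (H ⊗[ℂ] H) →ₗ[ℂ] H := LinearMap.mul' ℂ H ∘ₗ
    TensorProduct.map (antipode ℂ) (LinearMap.mul' ℂ H ∘ₗ TensorProduct.map LinearMap.id K)
  let r := Coalgebra.Repr.arbitrary ℂ a
  have key := congrArg G (Coalgebra.sum_tmul_tmul_eq r
    (fun i => Coalgebra.Repr.arbitrary ℂ (r.left i))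
    (fun i => Coalgebra.Repr.arbitrary ℂ (r.right i)))
  simp only [G, map_sum, LinearMap.comp_apply, TensorProduct.map_tmul, LinearMap.mul'_apply,
    LinearMap.id_apply] at key
  have hl : antipode ℂ (rightSlice h (Coalgebra.comul (R := ℂ) a * ((1 : H) ⊗ₜ[ℂ] b)))
      = ∑ i ∈ r.index, antipode ℂ (r.left i) *
          rightSlice h (Coalgebra.comul (R := ℂ) (r.right i) * Coalgebra.comul (R := ℂ) b) := by
    simp_rw [← Bialgebra.comul_mul, right_inv]
    conv_lhs => rw [← r.eq]
    simp [Finset.sum_mul, rightSlice_tmul]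
  rw [hl, hK, one_mul]
  calc _ = _ := by
        refine Finset.sum_congr rfl fun i _ => ?_
        conv_lhs => rw [← (Coalgebra.Repr.arbitrary ℂ (r.right i)).eq]
        rw [Finset.sum_mul, map_sum, Finset.mul_sum]
        simp_rw [hK]
    _ = _ := key.symm
    _ = K a := by
        simp_rw [← mul_assoc, ← Finset.sum_mul, sum_antipode_mul_eq_smul, smul_one_mul,
          ← map_smul, ← map_sum, Coalgebra.sum_counit_smul]

lemma rightSlice_corner_left {H : Type*} [Ring H] [StarRing H] [HopfAlgebra ℂ H]
    {h : H →ₗ[ℂ] ℂ} (hh : IsHaarState h) {p : H} (hp : p * p = p)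
    (a : H) (w : H ⊗[ℂ] H) :
    rightSlice h (((1 : H) ⊗ₜ[ℂ] (p * a * p)) * ((p ⊗ₜ[ℂ] p) * w * (p ⊗ₜ[ℂ] p)))
      = p * rightSlice h (((1 : H) ⊗ₜ[ℂ] (p * a * p)) * w) * p := by
  induction w with
  | zero => simp
  | tmul u v =>
    have : h (p * a * p * (p * v * p)) = h (p * a * p * v) := by
      rw [show p * a * p * (p * v * p) = p * a * (p * p) * v * p by noncomm_ring, hh.trace, hp]
      simp only [← mul_assoc, hp]
    simp [rightSlice_tmul, this]
  | add u v hu hv => simp only [mul_add, add_mul, map_add, hu, hv]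

lemma rightSlice_corner_right {H : Type*} [Ring H] [StarRing H] [HopfAlgebra ℂ H]
    {h : H →ₗ[ℂ] ℂ} (hh : IsHaarState h) {p : H} (hp : p * p = p)
    (b : H) (w : H ⊗[ℂ] H) :
    rightSlice h ((p ⊗ₜ[ℂ] p) * w * (p ⊗ₜ[ℂ] p) * ((1 : H) ⊗ₜ[ℂ] (p * b * p)))
      = p * rightSlice h (w * ((1 : H) ⊗ₜ[ℂ] (p * b * p))) * p := by
  induction w with
  | zero => simp
  | tmul u v =>
    have : h (p * v * p * (p * b * p)) = h (v * (p * b * p)) := by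
      rw [show p * v * p * (p * b * p) = p * (v * (p * p) * b * p) by noncomm_ring, hh.trace, hp]
      simp only [mul_assoc, hp]
    simp [rightSlice_tmul, this]
  | add u v hu hv => simp only [mul_add, add_mul, map_add, hu, hv]

/-- For a good group-like projection `p`, the antipode maps the corner `p A p` to itself and
satisfies the antipode relation for the compressed coproduct `Δ₀(x) = (p ⊗ p)Δ(x)(p ⊗ p)`:
`S((id ⊗ h)(Δ₀(p a p)·(1 ⊗ p b p))) = (id ⊗ h)((1 ⊗ p a p)·Δ₀(p b p))`. -/
theorem corner_antipode_relation
    (h : A →ₗ[ℂ] ℂ) (hh : IsHaarState h)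
    (tstar : A ⊗[ℂ] A →+ A ⊗[ℂ] A) (hstar : StarAxioms tstar)
    (p : A) (hp : IsGoodGroupLikeProjection p) :
    (∀ a : A, ∃ b : A, antipode (R := ℂ) (p * a * p) = p * b * p) ∧
    (∀ a b : A,
      antipode (R := ℂ) (TensorProduct.rid ℂ A (TensorProduct.map LinearMap.id h
        ((p ⊗ₜ[ℂ] p) * Coalgebra.comul (R := ℂ) (p * a * p) * (p ⊗ₜ[ℂ] p) *
          ((1 : A) ⊗ₜ[ℂ] (p * b * p)))))
      = TensorProduct.rid ℂ A (TensorProduct.map LinearMap.id h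
        (((1 : A) ⊗ₜ[ℂ] (p * a * p)) *
          ((p ⊗ₜ[ℂ] p) * Coalgebra.comul (R := ℂ) (p * b * p) * (p ⊗ₜ[ℂ] p))))) := by
  obtain ⟨⟨-, -, hpp, -⟩, -, hS⟩ := hp
  have antipode_corner (x : A) : antipode ℂ (p * x * p) = p * antipode ℂ x * p := by
    rw [antipode_mul_antidistrib, antipode_mul_antidistrib, hS, mul_assoc]
  refine ⟨fun a => ⟨antipode ℂ a, antipode_corner a⟩, fun a b => ?_⟩
  change antipode ℂ (rightSlice h _) = rightSlice h _
  rw [rightSlice_corner_right hh hpp, rightSlice_corner_left hh hpp, antipode_corner,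
    antipode_rightSlice_comul_mul hh]
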